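/- Uniform constants in the centered small ball probabilities of α-regular p-exponential measures (Lemma D.1): Let p ∈ [1,2], fix α₁ > 0, and for α ≥ α₁ let Π_α = Π(·|α, τ=1) be the α-regular p-exponential measure, and define φ₀(ε;α) = −log Π_α(εB_{ℓ₂}) = −log P(Σ_ℓ ℓ^{−1−2α}ξ_ℓ² ≤ ε²), where the ξ_ℓ are i.i.d. p-exponential. Then: (1) the limit lim_{ε→0} ε^{1/α}φ₀(ε;α) exists for each α ≥ α₁, and there exists a constant c̃ > 1 such that c̃^{−1}α ≤ lim_{ε→0} ε^{1/α}φ₀(ε;α) ≤ c̃α for all α ≥ α₁; (2) for any fixed α₂ > α₁ and any ε₀ > 0, there exists a constant c̃₁ > 0 such that c̃₁^{−1}ε^{−1/α} ≤ φ₀(ε;α) ≤ c̃₁ε^{−1/α} for all ε ∈ (0,ε₀] and all α ∈ [α₁,α₂]. -/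

import Mathlib

noncomputable section

open MeasureTheory ProbabilityTheory Filter Set

/-- The index `ℓ = i + 1 ≥ 1` associated to the coordinate `i : ℕ`. -/
def idx (i : ℕ) : ℝ := (i : ℝ) + 1

/-- The `p`-exponential probability density on `ℝ`:
`f_p(x) = exp(−|x|^p/p) / (2 Γ(1/p) p^{1/p−1})`. -/
def pexpDensity (p x : ℝ) : ℝ :=
  Real.exp (-|x| ^ p / p) / (2 * Real.Gamma (1 / p) * p ^ (1 / p - 1))

/-- The `p`-exponential probability measure on `ℝ`. -/
def pexpMeasure (p : ℝ) : Measure ℝ :=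
  MeasureTheory.volume.withDensity fun x => ENNReal.ofReal (pexpDensity p x)

/-- The law of the `i`-th coordinate `τ ℓ^{−1/2−α} ξ` (with `ℓ = i+1`) of a draw from the
`α`-regular `τ`-scaled `p`-exponential prior. -/
def coordLaw (p α τ : ℝ) (i : ℕ) : Measure ℝ :=
  (pexpMeasure p).map fun x => τ * idx i ^ (-(1 / 2 : ℝ) - α) * x

/-- `μ` is the `α`-regular `τ`-scaled `p`-exponential prior on `ℝ^ℕ`: the joint law of the
independent coordinates `τ ℓ^{−1/2−α} ξ_ℓ` with `ξ_ℓ` i.i.d. `p`-exponential. -/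
def IsPexpPrior (p α τ : ℝ) (μ : Measure (ℕ → ℝ)) : Prop :=
  IsProbabilityMeasure μ ∧
  IsProjectiveLimit μ fun I : Finset ℕ => Measure.pi fun i : I => coordLaw p α τ i

/-- `μ` is the Gaussian sequence model measure `P^n_θ`: the joint law of independent
coordinates `X_ℓ ~ N(θ_ℓ, 1/n)`. -/
def IsGaussModel (n : ℕ) (θ : ℕ → ℝ) (μ : Measure (ℕ → ℝ)) : Prop :=
  IsProbabilityMeasure μ ∧
  IsProjectiveLimit μ fun I : Finset ℕ =>
    Measure.pi fun i : I => gaussianReal (θ i) ((n : NNReal))⁻¹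

/-- The `ℓ₂` norm of a sequence (with the `tsum` junk-value convention). -/
def l2norm (θ : ℕ → ℝ) : ℝ := Real.sqrt (∑' i, θ i ^ 2)

/-- Membership in the Sobolev ball `H^β(L)`. -/
def inSobolevBall (β L : ℝ) (θ : ℕ → ℝ) : Prop :=
  Summable (fun i => idx i ^ (2 * β) * θ i ^ 2) ∧
    Real.sqrt (∑' i, idx i ^ (2 * β) * θ i ^ 2) ≤ L

/-- The log-likelihood `ℓ_n(θ) = n Σ_ℓ X_ℓ θ_ℓ − (n/2) ‖θ‖₂²` in the Gaussian sequence model. -/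
def loglik (n : ℕ) (θ X : ℕ → ℝ) : ℝ :=
  (n : ℝ) * (∑' i, X i * θ i) - (n : ℝ) / 2 * ∑' i, θ i ^ 2

/-- The likelihood ratio `p^n_θ(X) = dP^n_θ/dP^n_0 (X)`. -/
def lik (n : ℕ) (θ X : ℕ → ℝ) : ℝ := Real.exp (loglik n θ X)

/-- The marginal likelihood of the data `X` for the prior `prior`. -/
def marginalLik (n : ℕ) (prior : Measure (ℕ → ℝ)) (X : ℕ → ℝ) : ℝ :=
  ∫ θ, lik n θ X ∂prior

/-- The posterior mass of a set `B` given data `X`, for the prior `prior`. -/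
def post (n : ℕ) (prior : Measure (ℕ → ℝ)) (X : ℕ → ℝ) (B : Set (ℕ → ℝ)) : ℝ :=
  (∫ θ in B, lik n θ X ∂prior) / marginalLik n prior X

/-- The centered `ℓ₂`-ball of radius `ε`. -/
def l2Ball (ε : ℝ) : Set (ℕ → ℝ) := {θ | Summable (fun i => θ i ^ 2) ∧ l2norm θ ≤ ε}

/-- The centered small-ball exponent `φ₀(ε;α) = −log Π_α(ε B_{ℓ₂})`. -/
def smallBallExp (Pi : ℝ → Measure (ℕ → ℝ)) (ε α : ℝ) : ℝ :=
  -Real.log (Pi α (l2Ball ε)).toReal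

/-- The weighted sum `Σ_ℓ ℓ^{−1−2α} ω_ℓ²`, with values in `[0, ∞]`. -/
def weightedSqSum (α : ℝ) (ω : ℕ → ℝ) : ENNReal :=
  ∑' i, ENNReal.ofReal (idx i ^ (-1 - 2 * α) * ω i ^ 2)

/-- The probability that `Σ_ℓ ℓ^{−1−2α} ξ_ℓ² ≤ ε²` for i.i.d. `ξ_ℓ` with law `ν`. -/
def smallBallProb (ν : Measure ℝ) (α ε : ℝ) : ℝ :=
  (Measure.infinitePi fun _ : ℕ => ν).real {ω | weightedSqSum α ω ≤ ENNReal.ofReal (ε ^ 2)}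

lemma idx_pos (i : ℕ) : 0 < idx i := by unfold idx; positivity

@[fun_prop]
lemma measurable_weightedSqSum (α : ℝ) : Measurable (weightedSqSum α) := by
  unfold weightedSqSum
  fun_prop

lemma measurableSet_weightedSqSum_le (α : ℝ) (c : ENNReal) :
    MeasurableSet {ω | weightedSqSum α ω ≤ c} :=
  measurableSet_le (by fun_prop) measurable_const

lemma IsPexpPrior.eq_map {p α τ : ℝ} {P : Measure (ℕ → ℝ)} [IsProbabilityMeasure (pexpMeasure p)]
    (h : IsPexpPrior p α τ P) :
    P = (Measure.infinitePi fun _ : ℕ => pexpMeasure p).map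
      fun ω i => τ * idx i ^ (-(1 / 2 : ℝ) - α) * ω i := by
  have hprob (i : ℕ) : IsProbabilityMeasure (coordLaw p α τ i) :=
    Measure.isProbabilityMeasure_map (by fun_prop)
  rw [Measure.infinitePi_map_pi (f := fun i x => τ * idx i ^ (-(1 / 2 : ℝ) - α) * x) _
    (by fun_prop)]
  exact h.2.unique (Measure.isProjectiveLimit_infinitePi fun i => coordLaw p α τ i)

lemma scaled_mem_l2Ball_iff (α : ℝ) {ε : ℝ} (hε : 0 ≤ ε) (ω : ℕ → ℝ) :
    (fun i => 1 * idx i ^ (-(1 / 2 : ℝ) - α) * ω i) ∈ l2Ball ε ↔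
      weightedSqSum α ω ≤ ENNReal.ofReal (ε ^ 2) := by
  have hterm (i : ℕ) : (1 * idx i ^ (-(1 / 2 : ℝ) - α) * ω i) ^ 2 =
      idx i ^ (-1 - 2 * α) * ω i ^ 2 := by
    rw [mul_pow, one_mul, ← Real.rpow_natCast, ← Real.rpow_mul (idx_pos i).le]
    congr 2
    push_cast
    ring
  have hnn (i : ℕ) : 0 ≤ idx i ^ (-1 - 2 * α) * ω i ^ 2 :=
    mul_nonneg (Real.rpow_nonneg (idx_pos i).le _) (sq_nonneg _)
  simp only [l2Ball, l2norm, mem_ofPred_eq, hterm, weightedSqSum]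
  constructor
  · rintro ⟨hs, hle⟩
    rw [← ENNReal.ofReal_tsum_of_nonneg hnn hs]
    exact ENNReal.ofReal_le_ofReal ((Real.sqrt_le_left hε).1 hle)
  · intro hle
    have hs : Summable fun i => idx i ^ (-1 - 2 * α) * ω i ^ 2 := by
      have := ENNReal.summable_toReal (ne_top_of_le_ne_top ENNReal.ofReal_ne_top hle)
      simpa only [ENNReal.toReal_ofReal (hnn _)] using this
    refine ⟨hs, (Real.sqrt_le_left hε).2 ?_⟩
    rw [← ENNReal.ofReal_tsum_of_nonneg hnn hs] at hle
    exact (ENNReal.ofReal_le_ofReal_iff (sq_nonneg ε)).1 hle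

lemma smallBallExp_eq {p α : ℝ} (Pi : ℝ → Measure (ℕ → ℝ))
    [IsProbabilityMeasure (pexpMeasure p)] (h : IsPexpPrior p α 1 (Pi α)) {ε : ℝ} (hε : 0 ≤ ε) :
    smallBallExp Pi ε α = -Real.log (smallBallProb (pexpMeasure p) α ε) := by
  have hset : (fun (ω : ℕ → ℝ) i => 1 * idx i ^ (-(1 / 2 : ℝ) - α) * ω i) ⁻¹' l2Ball ε =
      {ω | weightedSqSum α ω ≤ ENNReal.ofReal (ε ^ 2)} := by
    ext ω
    exact scaled_mem_l2Ball_iff α hε ω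
  have hmeas : MeasurableSet (l2Ball ε) := by
    have : l2Ball ε = {θ | ∑' i, ENNReal.ofReal (θ i ^ 2) ≤ ENNReal.ofReal (ε ^ 2)} := by
      ext θ
      have := scaled_mem_l2Ball_iff α hε fun i => idx i ^ (1 / 2 + α) * θ i
      have h1 (i : ℕ) : 1 * idx i ^ (-(1 / 2 : ℝ) - α) * (idx i ^ (1 / 2 + α) * θ i) = θ i := by
        rw [one_mul, ← mul_assoc, ← Real.rpow_add (idx_pos i)]
        simp
      have h2 (i : ℕ) : idx i ^ (-1 - 2 * α) * (idx i ^ (1 / 2 + α) * θ i) ^ 2 = θ i ^ 2 := by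
        rw [mul_pow, ← Real.rpow_natCast (idx i ^ (1 / 2 + α)), ← Real.rpow_mul (idx_pos i).le,
          ← mul_assoc, ← Real.rpow_add (idx_pos i)]
        rw [show -1 - 2 * α + (1 / 2 + α) * ((2 : ℕ) : ℝ) = 0 by push_cast; ring,
          Real.rpow_zero, one_mul]
      simpa only [h1, h2, weightedSqSum, mem_ofPred_eq] using this
    rw [this]
    exact measurableSet_le (by fun_prop) measurable_const
  rw [smallBallExp, h.eq_map, Measure.map_apply (by fun_prop) hmeas, hset]
  rfl

lemma smallBallProb_nonneg (ν : Measure ℝ) (α ε : ℝ) : 0 ≤ smallBallProb ν α ε :=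
  measureReal_nonneg

section SelfSimilarity

variable {ν : Measure ℝ} [IsProbabilityMeasure ν]

lemma infinitePi_head_tail {A : Set ℝ} {B : Set (ℕ → ℝ)} (hA : MeasurableSet A)
    (hB : MeasurableSet B) :
    (Measure.infinitePi fun _ : ℕ => ν).real {ω | ω 0 ∈ A ∧ (fun k => ω (k + 1)) ∈ B} =
      ν.real A * (Measure.infinitePi fun _ : ℕ => ν).real B := by
  set μ := Measure.infinitePi fun _ : ℕ => ν with hμ
  have hind : iIndepFun (fun (i : ℕ) (ω : ℕ → ℝ) => ω i) μ :=
    iIndepFun_infinitePi (X := fun _ x => x) (by fun_prop)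
  have h01 : IndepFun (fun ω : ℕ → ℝ => ω 0) (fun ω k => ω (k + 1)) μ := by
    refine IndepFun.indepFun_process (Y := fun k (ω : ℕ → ℝ) => ω (k + 1)) (by fun_prop)
      (by fun_prop) fun I => ?_
    have := hind.indepFun_finset {0} (I.map ⟨Nat.succ, Nat.succ_injective⟩)
      (by simp) (by fun_prop)
    exact this.comp (φ := fun v : ({0} : Finset ℕ) → ℝ => v ⟨0, by simp⟩)
      (ψ := fun (v : I.map ⟨Nat.succ, Nat.succ_injective⟩ → ℝ) (k : I) => v ⟨k + 1, by simp⟩)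
      (by fun_prop) (by fun_prop)
  have htail : μ.map (fun ω k => ω (k + 1)) = μ :=
    Measure.map_infinitePi_infinitePi_of_inj (P := fun _ : ℕ => ν) (f := Nat.succ)
      Nat.succ_injective
  have hhead : μ.map (fun ω => ω 0) = ν := Measure.infinitePi_map_eval (fun _ : ℕ => ν) 0
  have h := h01.measure_inter_preimage_eq_mul A B hA hB
  rw [← Measure.map_apply (by fun_prop) hA, ← Measure.map_apply (by fun_prop) hB, hhead, htail] at h
  rw [measureReal_def, measureReal_def, measureReal_def, ← ENNReal.toReal_mul, ← h]
  rfl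

lemma map_blocks_infinitePi {m : ℕ} :
    (Measure.infinitePi fun _ : ℕ => ν).map (fun ω (j : Fin m) k => ω (m * k + j)) =
      Measure.infinitePi fun _ : Fin m => Measure.infinitePi fun _ : ℕ => ν := by
  have hinj : Function.Injective fun q : Fin m × ℕ => m * q.2 + q.1 := by
    rintro ⟨j, k⟩ ⟨j', k'⟩ h
    have hm : 0 < m := j.pos
    simp only at h
    have h1 := congrArg (· / m) h
    have h2 := congrArg (· % m) h
    simp only [Nat.mul_add_div hm, Nat.div_eq_of_lt j.2, Nat.div_eq_of_lt j'.2,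
      Nat.mul_add_mod, Nat.mod_eq_of_lt j.2, Nat.mod_eq_of_lt j'.2, add_zero] at h1 h2
    exact Prod.ext (Fin.ext h2) h1
  rw [← Measure.infinitePi_map_curry fun (_ : Fin m) (_ : ℕ) => ν,
    ← Measure.map_infinitePi_infinitePi_of_inj (P := fun _ : ℕ => ν) hinj,
    Measure.map_map (by fun_prop) (by fun_prop)]
  rfl

lemma weightedSqSum_le_sum_blocks {α : ℝ} (hα : 0 ≤ α) {m : ℕ} (hm : 0 < m) (ω : ℕ → ℝ) :
    weightedSqSum α ω ≤ ∑ j : Fin m, (ENNReal.ofReal (idx j ^ (-1 - 2 * α) * ω j ^ 2) +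
      ENNReal.ofReal ((m : ℝ) ^ (-1 - 2 * α)) *
        weightedSqSum α fun k => ω (m * (k + 1) + j)) := by
  have : NeZero m := ⟨hm.ne'⟩
  rw [weightedSqSum, ← (Nat.divModEquiv m).symm.tsum_eq, ENNReal.tsum_prod', ENNReal.tsum_comm,
    tsum_fintype]
  refine Finset.sum_le_sum fun j _ => ?_
  rw [tsum_eq_zero_add' ENNReal.summable]
  refine add_le_add (by simp [Nat.divModEquiv]) ?_
  rw [weightedSqSum, ← ENNReal.tsum_mul_left]
  refine ENNReal.tsum_le_tsum fun k => ?_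
  have hidx : (Nat.divModEquiv m).symm (k + 1, j) = m * (k + 1) + j := by
    simp [Nat.divModEquiv, mul_comm]
  have hm' : (0 : ℝ) < m := by exact_mod_cast hm
  rw [hidx, ← ENNReal.ofReal_mul (by positivity), ← mul_assoc,
    ← Real.mul_rpow hm'.le (idx_pos k).le]
  refine ENNReal.ofReal_le_ofReal (mul_le_mul_of_nonneg_right ?_ (sq_nonneg _))
  refine Real.rpow_le_rpow_of_nonpos (mul_pos hm' (idx_pos k)) ?_ (by linarith)
  simp only [idx]
  push_cast
  nlinarith [(Nat.cast_nonneg (j : ℕ) : (0 : ℝ) ≤ _)]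

lemma smallBallProb_le_one (α ε : ℝ) : smallBallProb ν α ε ≤ 1 := measureReal_le_one

lemma smallBallProb_mono {α ε ε' : ℝ} (hε : 0 ≤ ε) (h : ε ≤ ε') :
    smallBallProb ν α ε ≤ smallBallProb ν α ε' :=
  measureReal_mono fun ω (hω : weightedSqSum α ω ≤ _) => hω.trans
    (ENNReal.ofReal_le_ofReal (pow_le_pow_left₀ hε h 2))

/-- Splitting `ℕ` into residue classes mod `m` bounds a small ball probability from below by a
product of `m` small ball probabilities at a radius larger by the factor `m ^ α`. -/
lemma smallBallProb_self_similar {α : ℝ} (hα : 0 ≤ α) {m : ℕ} (hm : 0 < m) {a b ε : ℝ}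
    (hab : a ^ 2 + b ^ 2 ≤ ε ^ 2) :
    (∏ j : Fin m, ν.real {x | idx j ^ (-1 - 2 * α) * x ^ 2 ≤ a ^ 2 / m}) *
      smallBallProb ν α (b * (m : ℝ) ^ α) ^ m ≤ smallBallProb ν α ε := by
  have hm' : (0 : ℝ) < m := by exact_mod_cast hm
  set μ := Measure.infinitePi fun _ : ℕ => ν with hμ
  set A : Fin m → Set ℝ := fun j => {x | idx j ^ (-1 - 2 * α) * x ^ 2 ≤ a ^ 2 / m} with hA
  set B : Set (ℕ → ℝ) := {ω | weightedSqSum α ω ≤ ENNReal.ofReal ((b * (m : ℝ) ^ α) ^ 2)} with hB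
  set C : Fin m → Set (ℕ → ℝ) := fun j => {ω | ω 0 ∈ A j ∧ (fun k => ω (k + 1)) ∈ B} with hC
  have hAm (j : Fin m) : MeasurableSet (A j) := measurableSet_le (by fun_prop) measurable_const
  have hBm : MeasurableSet B := measurableSet_weightedSqSum_le α _
  have hCm (j : Fin m) : MeasurableSet (C j) :=
    (measurableSet_preimage (f := fun ω : ℕ → ℝ => ω 0) (by fun_prop) (hAm j)).inter
      (measurableSet_preimage (f := fun (ω : ℕ → ℝ) k => ω (k + 1)) (by fun_prop) hBm)
  have hsub : (fun ω (j : Fin m) k => ω (m * k + j)) ⁻¹' (Set.pi univ C) ⊆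
      {ω : ℕ → ℝ | weightedSqSum α ω ≤ ENNReal.ofReal (ε ^ 2)} := by
    intro ω hω
    have hω' (j : Fin m) := hω j (mem_univ j)
    refine (weightedSqSum_le_sum_blocks hα hm ω).trans ?_
    have hterm (j : Fin m) : ENNReal.ofReal (idx j ^ (-1 - 2 * α) * ω j ^ 2) +
        ENNReal.ofReal ((m : ℝ) ^ (-1 - 2 * α)) * weightedSqSum α (fun k => ω (m * (k + 1) + j)) ≤
        ENNReal.ofReal (a ^ 2 / m + b ^ 2 / m) := by
      rw [ENNReal.ofReal_add (by positivity) (by positivity)]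
      refine add_le_add (ENNReal.ofReal_le_ofReal (by simpa [hA] using (hω' j).1)) ?_
      refine (mul_le_mul_right (hω' j).2 _).trans ?_
      rw [← ENNReal.ofReal_mul (by positivity)]
      refine ENNReal.ofReal_le_ofReal (le_of_eq ?_)
      rw [mul_pow, ← Real.rpow_natCast ((m : ℝ) ^ α), ← Real.rpow_mul hm'.le, mul_left_comm,
        ← Real.rpow_add hm', show -1 - 2 * α + α * ((2 : ℕ) : ℝ) = -1 by push_cast; ring,
        Real.rpow_neg_one, div_eq_mul_inv]
    refine (Finset.sum_le_sum fun j _ => hterm j).trans ?_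
    rw [Finset.sum_const, Finset.card_univ, Fintype.card_fin, nsmul_eq_mul,
      ← ENNReal.ofReal_natCast, ← ENNReal.ofReal_mul (by positivity)]
    refine ENNReal.ofReal_le_ofReal ?_
    rw [← add_div, mul_div_cancel₀ _ hm'.ne']
    exact hab
  have hprod : μ.real ((fun ω (j : Fin m) k => ω (m * k + j)) ⁻¹' (Set.pi univ C)) =
      ∏ j : Fin m, μ.real (C j) := by
    rw [measureReal_def, ← Measure.map_apply (by fun_prop) (MeasurableSet.univ_pi hCm),
      map_blocks_infinitePi, Measure.infinitePi_eq_pi, Measure.pi_pi, ENNReal.toReal_prod]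
    rfl
  have hCval (j : Fin m) : μ.real (C j) = ν.real (A j) * μ.real B :=
    infinitePi_head_tail (hAm j) hBm
  calc _ = ∏ j : Fin m, μ.real (C j) := by
        simp only [hCval, Finset.prod_mul_distrib, Finset.prod_const, Finset.card_univ,
          Fintype.card_fin]
        rfl
    _ ≤ _ := hprod ▸ measureReal_mono hsub

end SelfSimilarity

section Estimates

variable {ν : Measure ℝ} [IsProbabilityMeasure ν]

lemma exp_neg_le_prod_idx_div (m : ℕ) :
    Real.exp (-m) ≤ ∏ j : Fin m, idx j / m := by
  rcases Nat.eq_zero_or_pos m with rfl | hm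
  · simp
  have hm' : (0 : ℝ) < m := by exact_mod_cast hm
  have hfac : ∏ j : Fin m, idx j = (m.factorial : ℝ) := by
    rw [Fin.prod_univ_eq_prod_range (fun i => idx i) m, ← Finset.prod_range_add_one_eq_factorial]
    push_cast
    rfl
  rw [Finset.prod_div_distrib, hfac, Finset.prod_const, Finset.card_univ, Fintype.card_fin,
    Real.exp_neg, ← inv_div]
  exact inv_anti₀ (by positivity) (Real.pow_div_factorial_le_exp _ hm'.le m)

lemma le_prod_measureReal_head {c : ℝ} (hc : 0 ≤ c)
    (hν : ∀ t : ℝ, 0 ≤ t → t ≤ 1 → c * t ≤ ν.real {x | |x| ≤ t})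
    {α : ℝ} (hα : 0 ≤ α) {m : ℕ} (hm : 0 < m) {a : ℝ} (ha : 0 ≤ a) :
    (c * (Real.exp (-(α + 1 / 2)) * min 1 (a * (m : ℝ) ^ α))) ^ m ≤
      ∏ j : Fin m, ν.real {x | idx j ^ (-1 - 2 * α) * x ^ 2 ≤ a ^ 2 / m} := by
  have hm' : (0 : ℝ) < m := by exact_mod_cast hm
  set s := min 1 (a * (m : ℝ) ^ α) with hs
  have hs0 : 0 ≤ s := le_min zero_le_one (by positivity)
  have hratio (j : Fin m) : 0 < idx j / m := div_pos (idx_pos j) hm'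
  have hratio' (j : Fin m) : idx j / m ≤ 1 := by
    rw [div_le_one hm', idx]
    exact_mod_cast j.2
  have hfactor (j : Fin m) : c * ((idx j / m) ^ (α + 1 / 2) * s) ≤
      ν.real {x | idx j ^ (-1 - 2 * α) * x ^ 2 ≤ a ^ 2 / m} := by
    have hp := Real.rpow_le_one (hratio j).le (hratio' j) (by linarith : 0 ≤ α + 1 / 2)
    have hp0 := Real.rpow_nonneg (hratio j).le (α + 1 / 2)
    refine (hν _ (by positivity) (mul_le_one₀ hp hs0 (min_le_left _ _))).trans ?_
    refine measureReal_mono fun x (hx : |x| ≤ _) => ?_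
    have hx2 : x ^ 2 ≤ ((idx j / m) ^ (α + 1 / 2) * s) ^ 2 := by
      rw [← sq_abs]
      exact pow_le_pow_left₀ (abs_nonneg x) hx 2
    have hs2 : s ^ 2 ≤ (a * (m : ℝ) ^ α) ^ 2 := pow_le_pow_left₀ hs0 (min_le_right _ _) 2
    have hi := idx_pos j
    calc idx j ^ (-1 - 2 * α) * x ^ 2
        ≤ idx j ^ (-1 - 2 * α) * (((idx j / m) ^ (α + 1 / 2)) ^ 2 * (a * (m : ℝ) ^ α) ^ 2) := by
          refine mul_le_mul_of_nonneg_left (hx2.trans ?_) (by positivity)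
          rw [mul_pow]
          gcongr
      _ = a ^ 2 / m := by
          rw [mul_pow, ← Real.rpow_natCast (_ ^ (α + 1 / 2)), ← Real.rpow_natCast (_ ^ α),
            ← Real.rpow_mul (hratio j).le, ← Real.rpow_mul hm'.le,
            Real.div_rpow hi.le hm'.le,
            show idx j ^ (-1 - 2 * α) = (idx j ^ ((α + 1 / 2) * ((2 : ℕ) : ℝ)))⁻¹ by
              rw [← Real.rpow_neg hi.le]; congr 1; push_cast; ring,
            show (m : ℝ) ^ ((α + 1 / 2) * ((2 : ℕ) : ℝ)) = m ^ (α * ((2 : ℕ) : ℝ)) * m by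
              rw [← Real.rpow_add_one hm'.ne']; congr 1; push_cast; ring]
          have h1 : 0 < idx j ^ ((α + 1 / 2) * ((2 : ℕ) : ℝ)) := Real.rpow_pos_of_pos hi _
          have h2 : 0 < (m : ℝ) ^ (α * ((2 : ℕ) : ℝ)) := Real.rpow_pos_of_pos hm' _
          field_simp
  refine le_trans ?_ (Finset.prod_le_prod (fun j _ => ?_) fun j _ => hfactor j)
  · rw [Finset.prod_mul_distrib, Finset.prod_mul_distrib,
      Real.finsetProd_rpow _ _ fun j _ => (hratio j).le]
    simp only [Finset.prod_const, Finset.card_univ, Fintype.card_fin]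
    rw [mul_pow, mul_pow]
    gcongr
    calc Real.exp (-(α + 1 / 2)) ^ m = Real.exp (-m) ^ (α + 1 / 2) := by
          rw [← Real.exp_nat_mul, ← Real.exp_mul]
          congr 1
          ring
      _ ≤ _ := Real.rpow_le_rpow (Real.exp_nonneg _) (exp_neg_le_prod_idx_div m) (by linarith)
  · have := Real.rpow_nonneg (hratio j).le (α + 1 / 2)
    positivity

/-- Logarithmic form of the self-similarity of small ball probabilities. -/
lemma smallBallProb_pos_and_neg_log_le {c : ℝ} (hc : 0 < c)
    (hν : ∀ t : ℝ, 0 ≤ t → t ≤ 1 → c * t ≤ ν.real {x | |x| ≤ t})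
    {α : ℝ} (hα : 0 ≤ α) {m : ℕ} (hm : 0 < m) {a b ε : ℝ} (ha : 0 < a)
    (hab : a ^ 2 + b ^ 2 ≤ ε ^ 2) (hb : 0 < smallBallProb ν α (b * (m : ℝ) ^ α)) :
    0 < smallBallProb ν α ε ∧ -Real.log (smallBallProb ν α ε) ≤
      m * (-Real.log c + (α + 1 / 2) - Real.log (min 1 (a * (m : ℝ) ^ α)) -
        Real.log (smallBallProb ν α (b * (m : ℝ) ^ α))) := by
  have hm' : (0 : ℝ) < m := by exact_mod_cast hm
  have hmin : 0 < min 1 (a * (m : ℝ) ^ α) := lt_min one_pos (by positivity)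
  set s := min 1 (a * (m : ℝ) ^ α)
  set q := smallBallProb ν α (b * (m : ℝ) ^ α)
  have key : (c * (Real.exp (-(α + 1 / 2)) * s)) ^ m * q ^ m ≤ smallBallProb ν α ε :=
    (mul_le_mul_of_nonneg_right (le_prod_measureReal_head hc.le hν hα hm ha.le)
      (by positivity)).trans (smallBallProb_self_similar hα hm hab)
  have hpos : 0 < (c * (Real.exp (-(α + 1 / 2)) * s)) ^ m * q ^ m := by positivity
  refine ⟨hpos.trans_le key, ?_⟩
  have hlog := Real.log_le_log hpos key
  rw [Real.log_mul (by positivity) (by positivity), Real.log_pow, Real.log_pow,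
    Real.log_mul (by positivity) (by positivity), Real.log_mul (by positivity) (by positivity),
    Real.log_exp] at hlog
  linarith

lemma exists_half_le_smallBallProb (hν : ∫⁻ x, ENNReal.ofReal (x ^ 2) ∂ν ≠ ⊤)
    {α₁ : ℝ} (hα₁ : 0 < α₁) :
    ∃ M : ℝ, 1 ≤ M ∧ ∀ α, α₁ ≤ α → 1 / 2 ≤ smallBallProb ν α M := by
  set μ := Measure.infinitePi fun _ : ℕ => ν with hμ
  set V : ENNReal := (∑' i, ENNReal.ofReal (idx i ^ (-1 - 2 * α₁))) *
    ∫⁻ x, ENNReal.ofReal (x ^ 2) ∂ν with hV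
  have hsum : Summable fun i : ℕ => idx i ^ (-1 - 2 * α₁) := by
    have h := (summable_nat_add_iff 1).2
      (Real.summable_nat_rpow (p := -1 - 2 * α₁) |>.2 (by linarith))
    simpa [idx] using h
  have hVtop : V ≠ ⊤ := ENNReal.mul_ne_top hsum.tsum_ofReal_ne_top hν
  have hmean (α : ℝ) (hα : α₁ ≤ α) : ∫⁻ ω, weightedSqSum α ω ∂μ ≤ V := by
    simp only [weightedSqSum]
    rw [lintegral_tsum (fun i => Measurable.aemeasurable (by fun_prop)), hV, ← ENNReal.tsum_mul_right]
    refine ENNReal.tsum_le_tsum fun i => ?_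
    have hi := idx_pos i
    have h1 : ∫⁻ ω : ℕ → ℝ, ENNReal.ofReal (ω i ^ 2) ∂μ = ∫⁻ x, ENNReal.ofReal (x ^ 2) ∂ν := by
      rw [← Measure.infinitePi_map_eval (fun _ : ℕ => ν) i,
        lintegral_map (by fun_prop) (by fun_prop)]
    simp_rw [ENNReal.ofReal_mul (Real.rpow_nonneg hi.le (-1 - 2 * α))]
    rw [lintegral_const_mul _ (by fun_prop), h1]
    refine mul_le_mul_left (ENNReal.ofReal_le_ofReal ?_) _
    exact Real.rpow_le_rpow_of_exponent_le (by simp [idx]) (by linarith)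
  refine ⟨2 * V.toReal + 1, by linarith [V.toReal_nonneg], fun α hα => ?_⟩
  set M := 2 * V.toReal + 1 with hM
  have hM1 : 1 ≤ M := by linarith [V.toReal_nonneg]
  have hmarkov := mul_meas_ge_le_lintegral (μ := μ) (measurable_weightedSqSum α)
    (ENNReal.ofReal (M ^ 2))
  have hreal : M ^ 2 * μ.real {ω | ENNReal.ofReal (M ^ 2) ≤ weightedSqSum α ω} ≤ V.toReal := by
    have := ENNReal.toReal_mono hVtop (hmarkov.trans (hmean α hα))
    rwa [ENNReal.toReal_mul, ENNReal.toReal_ofReal (by positivity)] at this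
  have hcompl : 1 - smallBallProb ν α M ≤
      μ.real {ω | ENNReal.ofReal (M ^ 2) ≤ weightedSqSum α ω} := by
    rw [smallBallProb, ← probReal_compl_eq_one_sub (measurableSet_weightedSqSum_le α _)]
    exact measureReal_mono fun ω hω => (not_le.1 (show ¬ weightedSqSum α ω ≤ _ from hω)).le
  nlinarith

lemma smallBallProb_le_pow {K : ℝ}
    (hν : ∀ u : ℝ, 0 < u → ∫ x, Real.exp (-u * x ^ 2) ∂ν ≤ K / √u)
    {α : ℝ} (hα : 0 ≤ α) {N : ℕ} (hN : 0 < N) {ε : ℝ} (hε : 0 < ε) :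
    smallBallProb ν α ε ≤ (Real.exp 1 * (K * ((N : ℝ) ^ α * ε))) ^ N := by
  have hN' : (0 : ℝ) < N := by exact_mod_cast hN
  set μ := Measure.infinitePi fun _ : ℕ => ν with hμ
  set δ := (N : ℝ) ^ α * ε with hδ
  have hδ0 : 0 < δ := by positivity
  set X : ℕ → (ℕ → ℝ) → ℝ := fun i ω => ω i ^ 2 with hX
  have hind : iIndepFun X μ := iIndepFun_infinitePi (X := fun _ x => x ^ 2) (by fun_prop)
  have hsub : {ω | weightedSqSum α ω ≤ ENNReal.ofReal (ε ^ 2)} ⊆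
      {ω | (∑ i ∈ Finset.range N, X i) ω ≤ N * δ ^ 2} := by
    intro ω hω
    have h1 := (ENNReal.sum_le_tsum (Finset.range N)).trans hω
    have hnn (i : ℕ) : 0 ≤ idx i ^ (-1 - 2 * α) * ω i ^ 2 :=
      mul_nonneg (Real.rpow_nonneg (idx_pos i).le _) (sq_nonneg _)
    rw [← ENNReal.ofReal_sum_of_nonneg fun i _ => hnn i,
      ENNReal.ofReal_le_ofReal_iff (sq_nonneg ε)] at h1
    have h2 : (N : ℝ) ^ (-1 - 2 * α) * ∑ i ∈ Finset.range N, ω i ^ 2 ≤ ε ^ 2 := by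
      refine le_trans ?_ h1
      rw [Finset.mul_sum]
      refine Finset.sum_le_sum fun i hi => mul_le_mul_of_nonneg_right ?_ (sq_nonneg _)
      refine Real.rpow_le_rpow_of_nonpos (idx_pos i) ?_ (by linarith)
      rw [idx]
      exact_mod_cast Finset.mem_range.1 hi
    simp only [mem_ofPred_eq, Finset.sum_apply, hX]
    have h3 : (N : ℝ) ^ (-1 - 2 * α) * (N * δ ^ 2) = ε ^ 2 := by
      rw [hδ, mul_pow, ← Real.rpow_natCast ((N : ℝ) ^ α), ← Real.rpow_mul hN'.le, ← mul_assoc,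
        ← mul_assoc, ← Real.rpow_add_one hN'.ne', ← Real.rpow_add hN',
        show -1 - 2 * α + 1 + α * ((2 : ℕ) : ℝ) = 0 by push_cast; ring, Real.rpow_zero, one_mul]
    rw [← h3] at h2
    exact le_of_mul_le_mul_left h2 (by positivity)
  set t := -(1 / δ ^ 2) with ht
  have ht0 : t ≤ 0 := by rw [ht]; exact neg_nonpos.2 (by positivity)
  have hmgf (i : ℕ) : mgf (X i) μ t ≤ K * δ := by
    have h1 : mgf (X i) μ t = ∫ x, Real.exp (t * x ^ 2) ∂ν := by
      have h := integral_map (μ := μ) (φ := fun ω => ω i) (f := fun x => Real.exp (t * x ^ 2))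
        (measurable_pi_apply i).aemeasurable (by fun_prop)
      rw [Measure.infinitePi_map_eval (fun _ : ℕ => ν) i] at h
      exact h.symm
    rw [h1]
    refine (hν (1 / δ ^ 2) (by positivity)).trans (le_of_eq ?_)
    rw [Real.sqrt_div zero_le_one, Real.sqrt_one, Real.sqrt_sq hδ0.le]
    field_simp
  have hint : Integrable (fun ω => Real.exp (t * (∑ i ∈ Finset.range N, X i) ω)) μ := by
    refine Integrable.of_bound (C := 1) (by fun_prop) (ae_of_all _ fun ω => ?_)
    rw [Real.norm_eq_abs, abs_of_pos (Real.exp_pos _), Real.exp_le_one_iff]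
    refine mul_nonpos_of_nonpos_of_nonneg ht0 ?_
    simp only [Finset.sum_apply, hX]
    positivity
  calc smallBallProb ν α ε
      ≤ μ.real {ω | (∑ i ∈ Finset.range N, X i) ω ≤ N * δ ^ 2} := measureReal_mono hsub
    _ ≤ Real.exp (-t * (N * δ ^ 2)) * mgf (∑ i ∈ Finset.range N, X i) μ t :=
        measure_le_le_exp_mul_mgf _ ht0 hint
    _ = Real.exp 1 ^ N * ∏ i ∈ Finset.range N, mgf (X i) μ t := by
        rw [hind.mgf_sum (by fun_prop), ← Real.exp_nat_mul, ht]
        congr 2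
        field_simp
    _ ≤ Real.exp 1 ^ N * ∏ i ∈ Finset.range N, (K * δ) := by
        refine mul_le_mul_of_nonneg_left ?_ (by positivity)
        exact Finset.prod_le_prod (fun i _ => mgf_nonneg) fun i _ => hmgf i
    _ = _ := by rw [Finset.prod_const, Finset.card_range, ← mul_pow]

lemma smallBallProb_le_measureReal_abs_le (α : ℝ) {ε : ℝ} (hε : 0 ≤ ε) :
    smallBallProb ν α ε ≤ ν.real {x | |x| ≤ ε} := by
  have hm : MeasurableSet {x : ℝ | |x| ≤ ε} := measurableSet_le (by fun_prop) measurable_const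
  have h : ν.real {x | |x| ≤ ε} =
      (Measure.infinitePi fun _ : ℕ => ν).real {ω | |ω 0| ≤ ε} := by
    have h := Measure.map_apply (μ := Measure.infinitePi fun _ : ℕ => ν)
      (f := fun ω => ω 0) (by fun_prop) hm
    rw [Measure.infinitePi_map_eval (fun _ : ℕ => ν) 0] at h
    exact congrArg ENNReal.toReal h
  rw [h]
  refine measureReal_mono fun ω hω => ?_
  have h1 := (ENNReal.le_tsum 0).trans hω
  rw [ENNReal.ofReal_le_ofReal_iff (sq_nonneg ε)] at h1
  exact abs_le_of_sq_le_sq (by simpa [idx] using h1) hε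

end Estimates

lemma exists_tendsto_of_eventually_le {ι : Type*} {l : Filter ι} [l.NeBot] {g w : ι → ℝ}
    (hg : ∀ᶠ t in l, 0 ≤ g t) (hw : Tendsto (fun s => w s - g s) l (nhds 0))
    (h : ∀ᶠ s in l, ∀ᶠ t in l, g t ≤ w s) : ∃ L, Tendsto g l (nhds L) := by
  obtain ⟨s₀, hs₀⟩ := h.exists
  have hbdd : l.IsBoundedUnder (· ≤ ·) g := ⟨w s₀, eventually_map.2 hs₀⟩
  have hcobdd : l.IsCoboundedUnder (· ≤ ·) g :=
    IsBoundedUnder.isCoboundedUnder_le ⟨0, eventually_map.2 hg⟩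
  refine ⟨limsup g l, Metric.tendsto_nhds.2 fun η hη => ?_⟩
  have hlt : ∀ᶠ s in l, g s < limsup g l + η :=
    eventually_lt_of_limsup_lt (by linarith) hbdd
  filter_upwards [h, hlt, (Metric.tendsto_nhds.1 hw) η hη] with s hs hs' hws
  have hle : limsup g l ≤ w s := limsup_le_of_le hcobdd hs
  rw [Real.dist_eq, abs_lt] at *
  constructor <;> linarith

section Asymptotics

variable {ν : Measure ℝ} [IsProbabilityMeasure ν]

lemma neg_log_smallBallProb_nonneg (α ε : ℝ) : 0 ≤ -Real.log (smallBallProb ν α ε) :=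
  neg_nonneg.2 (Real.log_nonpos (smallBallProb_nonneg ν α ε) (smallBallProb_le_one α ε))

lemma le_mul_ceil_rpow {α x r : ℝ} (hα : 0 < α) (hx : 0 < x) (hr : 0 < r) :
    r ≤ x * (⌈(r / x) ^ (1 / α)⌉₊ : ℝ) ^ α := by
  have h : r / x ≤ (⌈(r / x) ^ (1 / α)⌉₊ : ℝ) ^ α := by
    calc r / x = ((r / x) ^ (1 / α)) ^ α := by
          rw [← Real.rpow_mul (by positivity), one_div_mul_cancel hα.ne', Real.rpow_one]
      _ ≤ _ := Real.rpow_le_rpow (by positivity) (Nat.le_ceil _) hα.le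
  rwa [div_le_iff₀' hx] at h

lemma exists_neg_log_smallBallProb_le {c : ℝ} (hc : 0 < c)
    (hsmall : ∀ t : ℝ, 0 ≤ t → t ≤ 1 → c * t ≤ ν.real {x | |x| ≤ t})
    (hmom : ∫⁻ x, ENNReal.ofReal (x ^ 2) ∂ν ≠ ⊤) {α₁ : ℝ} (hα₁ : 0 < α₁) :
    ∃ C : ℝ, 0 < C ∧ ∀ α, α₁ ≤ α → ∀ ε : ℝ, 0 < ε → 0 < smallBallProb ν α ε ∧
      -Real.log (smallBallProb ν α ε) ≤ C * α * (ε ^ (-(1 / α)) + 1) := by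
  obtain ⟨M, hM1, hM⟩ := exists_half_le_smallBallProb hmom hα₁
  set A := max (-Real.log c + 1 / 2 + Real.log 2) 0 with hA
  have hA0 : 0 ≤ A := le_max_right _ _
  have hA1 : -Real.log c + 1 / 2 + Real.log 2 ≤ A := le_max_left _ _
  set D := (2 * M) ^ (1 / α₁) with hD
  have hD1 : 1 ≤ D := Real.one_le_rpow (by linarith) (by positivity)
  refine ⟨D * (A / α₁ + 1), by positivity, fun α hα ε hε => ?_⟩
  have hα0 : 0 < α := hα₁.trans_le hα
  set m := ⌈(M / (ε / 2)) ^ (1 / α)⌉₊ with hm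
  have hm0 : 0 < m := Nat.ceil_pos.2 (by positivity)
  have hMm : M ≤ ε / 2 * (m : ℝ) ^ α := le_mul_ceil_rpow hα0 (by positivity) (by linarith)
  have hhalf : 1 / 2 ≤ smallBallProb ν α (ε / 2 * (m : ℝ) ^ α) :=
    (hM α hα).trans (smallBallProb_mono (by linarith) hMm)
  obtain ⟨hpos, hle⟩ := smallBallProb_pos_and_neg_log_le (a := ε / 2) (b := ε / 2) (ε := ε) hc
    hsmall hα0.le hm0 (by positivity) (by nlinarith) (by linarith)
  refine ⟨hpos, ?_⟩
  have hlog2 : -Real.log 2 ≤ Real.log (smallBallProb ν α (ε / 2 * (m : ℝ) ^ α)) := by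
    rw [← Real.log_inv]
    exact Real.log_le_log (by norm_num) (by linarith)
  rw [min_eq_left (hM1.trans hMm), Real.log_one] at hle
  have hm_le : (m : ℝ) ≤ D * (ε ^ (-(1 / α)) + 1) := by
    have h1 : (m : ℝ) ≤ (M / (ε / 2)) ^ (1 / α) + 1 := (Nat.ceil_lt_add_one (by positivity)).le
    have h2 : (M / (ε / 2)) ^ (1 / α) = (2 * M) ^ (1 / α) * ε ^ (-(1 / α)) := by
      rw [Real.rpow_neg hε.le, ← div_eq_mul_inv, ← Real.div_rpow (by positivity) hε.le]
      congr 1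
      field_simp
    have h3 : (2 * M) ^ (1 / α) ≤ D :=
      Real.rpow_le_rpow_of_exponent_le (by linarith) (one_div_le_one_div_of_le hα₁ hα)
    have h4 : 0 ≤ ε ^ (-(1 / α)) := by positivity
    nlinarith
  have hAα : A + α ≤ (A / α₁ + 1) * α := by
    have : A ≤ A / α₁ * α := by
      rw [div_mul_eq_mul_div, le_div_iff₀ hα₁]
      exact mul_le_mul_of_nonneg_left hα hA0
    linarith
  calc _ ≤ (m : ℝ) * (A + α) := by
        refine hle.trans (mul_le_mul_of_nonneg_left ?_ (by positivity))
        linarith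
    _ ≤ D * (ε ^ (-(1 / α)) + 1) * ((A / α₁ + 1) * α) := by gcongr
    _ = _ := by ring

lemma exists_le_neg_log_smallBallProb {K : ℝ} (hK : 0 < K)
    (hmgf : ∀ u : ℝ, 0 < u → ∫ x, Real.exp (-u * x ^ 2) ∂ν ≤ K / √u) {α₁ : ℝ} (hα₁ : 0 < α₁) :
    ∃ b : ℝ, 0 < b ∧ ∀ α, α₁ ≤ α → ∀ ε : ℝ, 0 < ε → 1 ≤ b * ε ^ (-(1 / α)) →
      0 < smallBallProb ν α ε →
      α * (b / 2 * ε ^ (-(1 / α))) ≤ -Real.log (smallBallProb ν α ε) := by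
  set B := 1 + max (1 + Real.log K) 0 / α₁ with hB
  refine ⟨Real.exp (-B), Real.exp_pos _, fun α hα ε hε h1 hpos => ?_⟩
  have hα0 : 0 < α := hα₁.trans_le hα
  set y := Real.exp (-B) * ε ^ (-(1 / α)) with hy
  have hy0 : 0 < y := by positivity
  set N := ⌊y⌋₊ with hN
  have hN0 : 0 < N := Nat.floor_pos.2 h1
  have hNy : (N : ℝ) ≤ y := Nat.floor_le hy0.le
  have hN2 : y / 2 ≤ N := by
    have h2 : y < N + 1 := Nat.lt_floor_add_one y
    have h3 : (1 : ℝ) ≤ N := by exact_mod_cast hN0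
    linarith
  have hNα : (N : ℝ) ^ α * ε ≤ Real.exp (-B * α) := by
    calc (N : ℝ) ^ α * ε ≤ y ^ α * ε := by gcongr
      _ = Real.exp (-B * α) := by
        rw [hy, Real.mul_rpow (by positivity) (by positivity), ← Real.exp_mul,
          ← Real.rpow_mul hε.le, show -(1 / α) * α = -1 by field_simp, Real.rpow_neg_one,
          mul_assoc, inv_mul_cancel₀ hε.ne', mul_one]
  have hle : smallBallProb ν α ε ≤ (Real.exp 1 * (K * Real.exp (-B * α))) ^ N :=
    (smallBallProb_le_pow hmgf hα0.le hN0 hε).trans (by gcongr)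
  have hlog := Real.log_le_log hpos hle
  rw [Real.log_pow, Real.log_mul (by positivity) (by positivity),
    Real.log_mul (by positivity) (by positivity), Real.log_exp, Real.log_exp] at hlog
  have hBα : 1 + Real.log K - B * α ≤ -α := by
    have h2 : max (1 + Real.log K) 0 ≤ max (1 + Real.log K) 0 / α₁ * α := by
      rw [div_mul_eq_mul_div, le_div_iff₀ hα₁]
      exact mul_le_mul_of_nonneg_left hα (le_max_right _ _)
    have h3 := le_max_left (1 + Real.log K) 0
    rw [hB]
    linarith
  have h4 : (N : ℝ) * (1 + (Real.log K + -B * α)) ≤ N * -α :=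
    mul_le_mul_of_nonneg_left (by linarith) (by positivity)
  have h5 : α * (y / 2) ≤ α * N := by gcongr
  calc _ = α * (y / 2) := by rw [hy]; ring
    _ ≤ _ := by linarith

lemma exists_tendsto_rpow_mul_neg_log_smallBallProb {c : ℝ} (hc : 0 < c)
    (hsmall : ∀ t : ℝ, 0 ≤ t → t ≤ 1 → c * t ≤ ν.real {x | |x| ≤ t})
    (hmom : ∫⁻ x, ENNReal.ofReal (x ^ 2) ∂ν ≠ ⊤) {α : ℝ} (hα : 0 < α) :
    ∃ L : ℝ, Tendsto (fun ε => ε ^ (1 / α) * -Real.log (smallBallProb ν α ε))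
      (nhdsWithin 0 (Ioi 0)) (nhds L) := by
  obtain ⟨C, hC0, hC⟩ := exists_neg_log_smallBallProb_le hc hsmall hmom hα
  set g : ℝ → ℝ := fun ε => ε ^ (1 / α) * -Real.log (smallBallProb ν α ε) with hg
  set E := -Real.log c + (α + 1 / 2) with hE
  set u : ℝ → ℝ := fun s => (1 - s) ^ (-(1 / α)) + s with hu
  set v : ℝ → ℝ := fun s => s ^ (1 / α) * (E - 2 * Real.log s) with hv
  have hβ : 0 < 1 / α := by positivity
  have hev : ∀ᶠ s : ℝ in nhdsWithin 0 (Ioi 0), s ∈ Ioo (0 : ℝ) 1 := Ioo_mem_nhdsGT one_pos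
  have hid : Tendsto (fun s : ℝ => s) (nhdsWithin 0 (Ioi 0)) (nhds 0) :=
    tendsto_nhdsWithin_of_tendsto_nhds tendsto_id
  have hpow : Tendsto (fun s : ℝ => s ^ (1 / α)) (nhdsWithin 0 (Ioi 0)) (nhds 0) := by
    have h := hid.rpow_const (p := 1 / α) (Or.inr hβ.le)
    rwa [Real.zero_rpow hβ.ne'] at h
  have hu1 : Tendsto u (nhdsWithin 0 (Ioi 0)) (nhds 1) := by
    have h1 : Tendsto (fun s : ℝ => 1 - s) (nhdsWithin 0 (Ioi 0)) (nhds 1) := by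
      simpa using hid.const_sub 1
    simpa [hu] using (h1.rpow_const (p := -(1 / α)) (Or.inl one_ne_zero)).add hid
  have hv0 : Tendsto v (nhdsWithin 0 (Ioi 0)) (nhds 0) := by
    have h1 := tendsto_log_mul_rpow_nhdsGT_zero hβ
    have h2 := (hpow.const_mul E).sub (h1.const_mul 2)
    rw [mul_zero, mul_zero, sub_zero] at h2
    refine h2.congr fun s => ?_
    simp only [hv]
    ring
  have hgbdd : ∀ᶠ s in nhdsWithin (0 : ℝ) (Ioi 0), ‖g s‖ ≤ 2 * (C * α) := by
    filter_upwards [hev] with s hs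
    have hs0 := hs.1
    have h1 := (hC α le_rfl s hs0).2
    have h2 : 0 ≤ s ^ (1 / α) := by positivity
    have h3 : s ^ (1 / α) ≤ 1 := Real.rpow_le_one hs0.le hs.2.le hβ.le
    have h4 : s ^ (1 / α) * s ^ (-(1 / α)) = 1 := by
      rw [← Real.rpow_add hs0, add_neg_cancel, Real.rpow_zero]
    rw [Real.norm_eq_abs, abs_of_nonneg (mul_nonneg h2 (neg_log_smallBallProb_nonneg α s))]
    calc s ^ (1 / α) * -Real.log (smallBallProb ν α s)
        ≤ s ^ (1 / α) * (C * α * (s ^ (-(1 / α)) + 1)) := by gcongr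
      _ = C * α * (s ^ (1 / α) * s ^ (-(1 / α)) + s ^ (1 / α)) := by ring
      _ ≤ C * α * (1 + 1) := by rw [h4]; gcongr
      _ = _ := by ring
  refine exists_tendsto_of_eventually_le (w := fun s => u s * (v s + g s)) ?_ ?_ ?_
  · filter_upwards [hev] with s hs
    exact mul_nonneg (Real.rpow_nonneg hs.1.le _) (neg_log_smallBallProb_nonneg α s)
  · have h1 : Tendsto (fun s => (u s - 1) * g s) (nhdsWithin 0 (Ioi 0)) (nhds 0) := by
      have h2 : Tendsto (fun s => u s - 1) (nhdsWithin 0 (Ioi 0)) (nhds 0) := by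
        simpa using hu1.sub_const 1
      exact h2.zero_mul_isBoundedUnder_le ⟨_, eventually_map.2 hgbdd⟩
    have h3 := (hu1.mul hv0).add h1
    rw [mul_zero, add_zero] at h3
    refine h3.congr fun s => ?_
    ring
  · filter_upwards [hev] with s hs
    obtain ⟨hs0, hs1⟩ := hs
    have hbound : 0 < s * s ^ (1 / α) := by positivity
    filter_upwards [hev, hpow.eventually (gt_mem_nhds hbound)] with ε hε hεs
    obtain ⟨hε0, -⟩ := hε
    have hs1' : 0 < 1 - s := by linarith
    set b := (1 - s) * ε with hb
    have hb0 : 0 < b := by positivity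
    set m := ⌈(s / b) ^ (1 / α)⌉₊ with hm
    have hm0 : 0 < m := Nat.ceil_pos.2 (by positivity)
    have hsm : s ≤ b * (m : ℝ) ^ α := le_mul_ceil_rpow hα hb0 hs0
    have hPs := (hC α le_rfl s hs0).1
    have hmono := smallBallProb_mono (ν := ν) (α := α) hs0.le hsm
    have hle := (smallBallProb_pos_and_neg_log_le (a := s * ε) (b := b) (ε := ε) hc
      hsmall hα.le hm0 (by positivity) (by rw [hb]; nlinarith [mul_pos hs0 hs1', sq_nonneg ε])
      (hPs.trans_le hmono)).2
    have hlogP := Real.log_le_log hPs hmono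
    have hmin : s ^ 2 ≤ min 1 (s * ε * (m : ℝ) ^ α) := by
      refine le_min (pow_le_one₀ hs0.le hs1.le) ?_
      have h1 : b * (m : ℝ) ^ α ≤ ε * (m : ℝ) ^ α := by
        rw [hb]
        gcongr
        nlinarith
      nlinarith
    have hlogmin := Real.log_le_log (by positivity) hmin
    rw [Real.log_pow] at hlogmin
    push_cast at hlogmin
    set T := E - 2 * Real.log s - Real.log (smallBallProb ν α s) with hT
    have hφT : -Real.log (smallBallProb ν α ε) ≤ m * T :=
      hle.trans (mul_le_mul_of_nonneg_left (by linarith) (by positivity))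
    have hT0 : 0 ≤ T := by
      have h1 := (neg_log_smallBallProb_nonneg (ν := ν) α ε).trans hφT
      exact nonneg_of_mul_nonneg_right h1 (by positivity)
    have hmε : ε ^ (1 / α) * m ≤ s ^ (1 / α) * u s := by
      have h1 : (m : ℝ) ≤ (s / b) ^ (1 / α) + 1 := (Nat.ceil_lt_add_one (by positivity)).le
      have h2 : ε ^ (1 / α) * (s / b) ^ (1 / α) = s ^ (1 / α) * (1 - s) ^ (-(1 / α)) := by
        rw [Real.rpow_neg hs1'.le, ← div_eq_mul_inv, ← Real.div_rpow hs0.le hs1'.le,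
          ← Real.mul_rpow hε0.le (by positivity)]
        congr 1
        rw [hb]
        field_simp
      calc ε ^ (1 / α) * m ≤ ε ^ (1 / α) * ((s / b) ^ (1 / α) + 1) := by gcongr
        _ = s ^ (1 / α) * (1 - s) ^ (-(1 / α)) + ε ^ (1 / α) := by rw [mul_add, h2, mul_one]
        _ ≤ s ^ (1 / α) * (1 - s) ^ (-(1 / α)) + s * s ^ (1 / α) := by linarith
        _ = _ := by simp only [hu]; ring
    calc g ε ≤ ε ^ (1 / α) * (m * T) := by
          simp only [hg]
          gcongr
      _ = ε ^ (1 / α) * m * T := by ring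
      _ ≤ s ^ (1 / α) * u s * T := by gcongr
      _ = _ := by simp only [hv, hg, hT]; ring

end Asymptotics

section PexpMeasure

variable {p : ℝ}

lemma pexpDensity_normalizer_pos (hp : 0 < p) :
    0 < 2 * Real.Gamma (1 / p) * p ^ (1 / p - 1) := by
  have := Real.Gamma_pos_of_pos (one_div_pos.2 hp)
  positivity

lemma pexpDensity_pos (hp : 0 < p) (x : ℝ) : 0 < pexpDensity p x :=
  div_pos (Real.exp_pos _) (pexpDensity_normalizer_pos hp)

@[fun_prop]
lemma measurable_pexpDensity (p : ℝ) : Measurable (pexpDensity p) := by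
  unfold pexpDensity
  fun_prop

lemma pexpDensity_le_of_abs_le (hp : 0 < p) {x y : ℝ} (h : |x| ≤ |y|) :
    pexpDensity p y ≤ pexpDensity p x := by
  have := pexpDensity_normalizer_pos hp
  have h1 : |x| ^ p ≤ |y| ^ p := Real.rpow_le_rpow (abs_nonneg x) h hp.le
  unfold pexpDensity
  gcongr

lemma integral_pexpDensity (hp : 0 < p) : ∫ x, pexpDensity p x = 1 := by
  have hΓ := Real.Gamma_pos_of_pos (one_div_pos.2 hp)
  have h1 : ∫ x : ℝ in Ioi 0, Real.exp (-x ^ p / p) =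
      p ^ (1 / p) * Real.Gamma (1 / p + 1) := by
    have h := integral_exp_neg_mul_rpow hp (one_div_pos.2 hp)
    rw [one_div, Real.inv_rpow hp.le, ← Real.rpow_neg hp.le, neg_div, neg_neg, one_div] at h
    rw [one_div, ← h]
    refine integral_congr_ae (ae_of_all _ fun x => ?_)
    simp only
    congr 1
    field_simp
  simp only [pexpDensity]
  rw [integral_div, integral_comp_abs (f := fun x => Real.exp (-x ^ p / p)), h1,
    Real.Gamma_add_one (by positivity), Real.rpow_sub_one hp.ne']
  have : 0 < p ^ (1 / p) := by positivity
  field_simp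

lemma integrable_pexpDensity (hp : 0 < p) : Integrable (pexpDensity p) :=
  .of_integral_ne_zero (by rw [integral_pexpDensity hp]; exact one_ne_zero)

lemma isProbabilityMeasure_pexpMeasure (hp : 0 < p) : IsProbabilityMeasure (pexpMeasure p) := by
  refine ⟨?_⟩
  rw [pexpMeasure, withDensity_apply _ MeasurableSet.univ, Measure.restrict_univ,
    ← ofReal_integral_eq_lintegral_ofReal (integrable_pexpDensity hp)
      (ae_of_all _ fun x => (pexpDensity_pos hp x).le), integral_pexpDensity hp, ENNReal.ofReal_one]

lemma mul_le_pexpMeasure_real_abs_le (hp : 0 < p) {t : ℝ} (ht : t ≤ 1) :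
    2 * pexpDensity p 1 * t ≤ (pexpMeasure p).real {x | |x| ≤ t} := by
  have := isProbabilityMeasure_pexpMeasure hp
  have hd := pexpDensity_pos hp 1
  have hset : {x : ℝ | |x| ≤ t} = Icc (-t) t := by ext x; simp [abs_le]
  rw [measureReal_def, ← ENNReal.ofReal_le_iff_le_toReal (measure_ne_top _ _), hset, pexpMeasure,
    withDensity_apply _ measurableSet_Icc]
  calc ENNReal.ofReal (2 * pexpDensity p 1 * t)
      = ∫⁻ _ in Icc (-t) t, ENNReal.ofReal (pexpDensity p 1) := by
        rw [setLIntegral_const, Real.volume_Icc, ← ENNReal.ofReal_mul hd.le]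
        congr 1
        ring
    _ ≤ _ := by
        refine setLIntegral_mono (by fun_prop) fun x hx => ENNReal.ofReal_le_ofReal ?_
        refine pexpDensity_le_of_abs_le hp ?_
        rw [abs_one]
        exact (abs_le.2 hx).trans ht

lemma lintegral_sq_pexpMeasure_ne_top (hp : 0 < p) :
    ∫⁻ x, ENNReal.ofReal (x ^ 2) ∂pexpMeasure p ≠ ⊤ := by
  have habs : Integrable fun x : ℝ => |x| ^ (2 : ℝ) * Real.exp (-(1 / p) * |x| ^ p) := by
    refine .of_integral_ne_zero ?_
    rw [integral_comp_abs (f := fun x => x ^ (2 : ℝ) * Real.exp (-(1 / p) * x ^ p)),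
      integral_rpow_mul_exp_neg_mul_rpow hp (by norm_num) (one_div_pos.2 hp)]
    have := Real.Gamma_pos_of_pos (show 0 < ((2 : ℝ) + 1) / p by positivity)
    positivity
  have hint : Integrable fun x => x ^ 2 * pexpDensity p x := by
    refine (habs.div_const (2 * Real.Gamma (1 / p) * p ^ (1 / p - 1))).congr
      (ae_of_all _ fun x => ?_)
    simp only [pexpDensity, Real.rpow_two, sq_abs]
    rw [mul_div_assoc, neg_mul, one_div_mul_eq_div, neg_div]
  rw [pexpMeasure, lintegral_withDensity_eq_lintegral_mul _ (by fun_prop) (by fun_prop)]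
  refine ne_of_lt ?_
  refine lt_of_eq_of_lt (lintegral_congr fun x => ?_) hint.lintegral_lt_top
  rw [Pi.mul_apply, ← ENNReal.ofReal_mul (pexpDensity_pos hp x).le, mul_comm]

lemma integral_exp_neg_mul_sq_pexpMeasure_le (hp : 0 < p) {u : ℝ} (hu : 0 < u) :
    ∫ x, Real.exp (-u * x ^ 2) ∂pexpMeasure p ≤ pexpDensity p 0 * √Real.pi / √u := by
  have hd := pexpDensity_pos hp
  rw [pexpMeasure, integral_withDensity_eq_integral_toReal_smul (by fun_prop)
    (ae_of_all _ fun x => ENNReal.ofReal_lt_top)]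
  calc _ ≤ ∫ x, pexpDensity p 0 * Real.exp (-u * x ^ 2) := by
        refine integral_mono_of_nonneg (ae_of_all _ fun x => by positivity)
          ((integrable_exp_neg_mul_sq hu).const_mul _) (ae_of_all _ fun x => ?_)
        simp only [ENNReal.toReal_ofReal (hd x).le, smul_eq_mul]
        refine mul_le_mul_of_nonneg_right (pexpDensity_le_of_abs_le hp ?_) (Real.exp_nonneg _)
        simp
    _ = _ := by
        rw [integral_const_mul, integral_gaussian, Real.sqrt_div Real.pi_pos.le, mul_div_assoc]

lemma pexpMeasure_real_abs_le_lt_one (hp : 0 < p) (t : ℝ) :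
    (pexpMeasure p).real {x | |x| ≤ t} < 1 := by
  have := isProbabilityMeasure_pexpMeasure hp
  have hm : MeasurableSet {x : ℝ | |x| ≤ t} := measurableSet_le (by fun_prop) measurable_const
  have hpos : 0 < (pexpMeasure p).real {x | |x| ≤ t}ᶜ := by
    rw [measureReal_def, ENNReal.toReal_pos_iff]
    refine ⟨pos_iff_ne_zero.2 fun h0 => ?_, measure_lt_top _ _⟩
    rw [pexpMeasure, withDensity_apply_eq_zero (by fun_prop)] at h0
    have hsub : Ioi t ⊆ {x | ENNReal.ofReal (pexpDensity p x) ≠ 0} ∩ {x | |x| ≤ t}ᶜ := by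
      refine fun x (hx : t < x) => ⟨(ENNReal.ofReal_pos.2 (pexpDensity_pos hp x)).ne', ?_⟩
      exact fun hle : |x| ≤ t => (hx.trans_le (le_abs_self x)).not_ge hle
    have h := measure_mono_null hsub h0
    rw [Real.volume_Ioi] at h
    exact ENNReal.top_ne_zero h
  rw [probReal_compl_eq_one_sub hm] at hpos
  linarith

end PexpMeasure

/-- **Lemma D.1**: the centered small ball exponents of `α`-regular `p`-exponential measures
satisfy `ε^{1/α} φ₀(ε;α) → C(α) ≍ α` as `ε → 0`, uniformly over `α ≥ α₁`, and two-sided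
bounds `φ₀(ε;α) ≍ ε^{−1/α}` hold with constants uniform over `α` in compact intervals. -/
theorem small_ball_uniform_constants
    (p : ℝ) (hp : p ∈ Set.Icc (1 : ℝ) 2)
    (α₁ : ℝ) (hα₁ : 0 < α₁)
    -- the α-regular p-exponential measures Π_α = Π(·|α, τ = 1)
    (Pi : ℝ → Measure (ℕ → ℝ))
    (hPi : ∀ α : ℝ, α₁ ≤ α → IsPexpPrior p α 1 (Pi α)) :
    -- (1): existence of the limit and two-sided linear-in-α bounds, uniformly in α ≥ α₁
    (∃ ctil : ℝ, 1 < ctil ∧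
      ∀ α : ℝ, α₁ ≤ α →
        ∃ l : ℝ,
          Filter.Tendsto (fun ε : ℝ => ε ^ (1 / α) * smallBallExp Pi ε α)
            (nhdsWithin 0 (Set.Ioi 0)) (nhds l) ∧
          ctil⁻¹ * α ≤ l ∧ l ≤ ctil * α) ∧
    -- (2): nonasymptotic two-sided bounds, uniform over α ∈ [α₁, α₂] and ε ∈ (0, ε₀]
    (∀ α₂ : ℝ, α₁ < α₂ → ∀ ε₀ : ℝ, 0 < ε₀ →
      ∃ ctil₁ : ℝ, 0 < ctil₁ ∧
        ∀ ε : ℝ, 0 < ε → ε ≤ ε₀ → ∀ α ∈ Set.Icc α₁ α₂,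
          ctil₁⁻¹ * ε ^ (-(1 / α)) ≤ smallBallExp Pi ε α ∧
          smallBallExp Pi ε α ≤ ctil₁ * ε ^ (-(1 / α))) := by
  have hp0 : 0 < p := by linarith [hp.1]
  have := isProbabilityMeasure_pexpMeasure hp0
  have hc : 0 < 2 * pexpDensity p 1 := mul_pos two_pos (pexpDensity_pos hp0 1)
  have hsmall (t : ℝ) (_ : 0 ≤ t) (ht : t ≤ 1) := mul_le_pexpMeasure_real_abs_le hp0 ht
  have hmom := lintegral_sq_pexpMeasure_ne_top hp0
  have hK : 0 < pexpDensity p 0 * √Real.pi :=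
    mul_pos (pexpDensity_pos hp0 0) (Real.sqrt_pos.2 Real.pi_pos)
  obtain ⟨C, hC0, hC⟩ := exists_neg_log_smallBallProb_le hc hsmall hmom hα₁
  obtain ⟨b, hb0, hb⟩ := exists_le_neg_log_smallBallProb hK
    (fun u hu => integral_exp_neg_mul_sq_pexpMeasure_le hp0 hu) hα₁
  have hφ (α : ℝ) (hα : α₁ ≤ α) {ε : ℝ} (hε : 0 < ε) := smallBallExp_eq Pi (hPi α hα) hε.le
  have hmulpow (α : ℝ) {ε : ℝ} (hε : 0 < ε) : ε ^ (1 / α) * ε ^ (-(1 / α)) = 1 := by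
    rw [← Real.rpow_add hε, add_neg_cancel, Real.rpow_zero]
  constructor
  · have h2b : 0 < 2 / b := by positivity
    refine ⟨2 * C + 2 / b + 1, by linarith, fun α hα => ?_⟩
    have hα0 : 0 < α := hα₁.trans_le hα
    have hβ : 0 < 1 / α := by positivity
    obtain ⟨l, hl⟩ := exists_tendsto_rpow_mul_neg_log_smallBallProb hc hsmall hmom hα0
    refine ⟨l, hl.congr' ?_, ?_, ?_⟩
    · filter_upwards [self_mem_nhdsWithin] with ε hε
      rw [hφ α hα hε]
    · have hpow : Tendsto (fun s : ℝ => s ^ (1 / α)) (nhdsWithin 0 (Ioi 0)) (nhds 0) := by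
        have hid : Tendsto (fun s : ℝ => s) (nhdsWithin 0 (Ioi 0)) (nhds 0) :=
          tendsto_nhdsWithin_of_tendsto_nhds tendsto_id
        have h := hid.rpow_const (p := 1 / α) (Or.inr hβ.le)
        rwa [Real.zero_rpow hβ.ne'] at h
      have hlow : b / 2 * α ≤ l := by
        refine ge_of_tendsto hl ?_
        filter_upwards [self_mem_nhdsWithin, hpow.eventually (gt_mem_nhds hb0)] with ε hε hεb
        have hε0 : 0 < ε := hε
        have h0 : 0 < ε ^ (-(1 / α)) := by positivity
        have h1 : 1 ≤ b * ε ^ (-(1 / α)) :=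
          (hmulpow α hε0).symm.trans_le (mul_le_mul_of_nonneg_right hεb.le h0.le)
        calc b / 2 * α = b / 2 * α * (ε ^ (1 / α) * ε ^ (-(1 / α))) := by
              rw [hmulpow α hε0, mul_one]
          _ = ε ^ (1 / α) * (α * (b / 2 * ε ^ (-(1 / α)))) := by ring
          _ ≤ _ := mul_le_mul_of_nonneg_left (hb α hα ε hε0 h1 (hC α hα ε hε0).1) (by positivity)
      refine le_trans (mul_le_mul_of_nonneg_right ?_ hα0.le) hlow
      rw [← inv_div 2 b]
      exact inv_anti₀ h2b (by linarith)
    · have hup : l ≤ 2 * C * α := by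
        refine le_of_tendsto hl ?_
        filter_upwards [Ioo_mem_nhdsGT one_pos] with ε hε
        have h1 : ε ^ (1 / α) ≤ 1 := Real.rpow_le_one hε.1.le hε.2.le hβ.le
        have h0 : 0 ≤ ε ^ (1 / α) := Real.rpow_nonneg hε.1.le _
        calc _ ≤ ε ^ (1 / α) * (C * α * (ε ^ (-(1 / α)) + 1)) :=
              mul_le_mul_of_nonneg_left (hC α hα ε hε.1).2 h0
          _ = C * α * (ε ^ (1 / α) * ε ^ (-(1 / α)) + ε ^ (1 / α)) := by ring
          _ ≤ C * α * (1 + 1) := by rw [hmulpow α hε.1]; gcongr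
          _ = _ := by ring
      exact hup.trans (mul_le_mul_of_nonneg_right (by linarith) hα0.le)
  · intro α₂ hα₂ ε₀ hε₀
    have hα₂0 : 0 < α₂ := hα₁.trans hα₂
    set q := (pexpMeasure p).real {x | |x| ≤ ε₀} with hq
    have hq1 : q < 1 := pexpMeasure_real_abs_le_lt_one hp0 ε₀
    have hq0 : 0 < q := (hC α₁ le_rfl ε₀ hε₀).1.trans_le
      (smallBallProb_le_measureReal_abs_le α₁ hε₀.le)
    have hlogq : 0 < -Real.log q := neg_pos.2 (Real.log_neg hq0 hq1)
    set U := C * α₂ * (1 + max ε₀ 1 ^ (1 / α₁)) with hU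
    set lo := min (α₁ * (b / 2)) (b * -Real.log q) with hlo
    have hlo0 : 0 < lo := lt_min (by positivity) (by positivity)
    have hU0 : 0 < U := by positivity
    refine ⟨max U lo⁻¹, lt_max_of_lt_left hU0, fun ε hε hεε₀ α hα => ?_⟩
    have hα0 : 0 < α := hα₁.trans_le hα.1
    have hx : 0 < ε ^ (-(1 / α)) := by positivity
    obtain ⟨hpos, hle⟩ := hC α hα.1 ε hε
    rw [hφ α hα.1 hε]
    constructor
    · have h1 : (max U lo⁻¹)⁻¹ ≤ lo :=
        inv_le_of_inv_le₀ hlo0 (le_max_right _ _)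
      refine (mul_le_mul_of_nonneg_right h1 hx.le).trans ?_
      rcases le_or_gt 1 (b * ε ^ (-(1 / α))) with h | h
      · refine le_trans ?_ (hb α hα.1 ε hε h hpos)
        rw [← mul_assoc]
        refine mul_le_mul_of_nonneg_right ((min_le_left _ _).trans ?_) hx.le
        exact mul_le_mul_of_nonneg_right hα.1 (by positivity)
      · have h2 : Real.log (smallBallProb (pexpMeasure p) α ε) ≤ Real.log q :=
          Real.log_le_log hpos ((smallBallProb_mono hε.le hεε₀).trans
            (smallBallProb_le_measureReal_abs_le α hε₀.le))
        calc lo * ε ^ (-(1 / α)) ≤ b * -Real.log q * ε ^ (-(1 / α)) :=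
              mul_le_mul_of_nonneg_right (min_le_right _ _) hx.le
          _ = -Real.log q * (b * ε ^ (-(1 / α))) := by ring
          _ ≤ -Real.log q * 1 := mul_le_mul_of_nonneg_left h.le hlogq.le
          _ ≤ _ := by linarith
    · refine le_trans (hle.trans ?_) (mul_le_mul_of_nonneg_right (le_max_left U lo⁻¹) hx.le)
      have h1 : ε ^ (1 / α) ≤ max ε₀ 1 ^ (1 / α₁) :=
        (Real.rpow_le_rpow hε.le (hεε₀.trans (le_max_left _ _)) (by positivity)).trans
          (Real.rpow_le_rpow_of_exponent_le (le_max_right _ _)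
            (one_div_le_one_div_of_le hα₁ hα.1))
      have h2 : 1 ≤ max ε₀ 1 ^ (1 / α₁) * ε ^ (-(1 / α)) :=
        (hmulpow α hε).symm.trans_le (mul_le_mul_of_nonneg_right h1 hx.le)
      calc _ ≤ C * α₂ * (ε ^ (-(1 / α)) + max ε₀ 1 ^ (1 / α₁) * ε ^ (-(1 / α))) := by
            gcongr
            exact hα.2
        _ = _ := by rw [hU]; ring
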